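/- arXiv:2512.09624 — 2 statements merged into one kernel-verified Lean document; each statement's English description precedes it below -/
import Mathlib

section
/- Let X be a compact metric space, T:X→X continuous, η a Borel probability measure on X, and ψ:X→ℝ continuous. Let (n_k) be strictly increasing, F⊆ℕ Fölner along (n_k) with positive lower asymptotic density along (n_k), and let A_{n_k} be Borel sets with η(A_{n_k}) > 0 and (1/n_k) log η(A_{n_k}) → 0. Assume the Fölner–Gibbs property: there is ε > 0 such that for every finite Borel partition P of X with diameter less than ε there is N∈ℕ with: for every n_k > N and every x∈A_{n_k}, η(P^{F_{n_k}}(x) ∩ A_{n_k}) ≤ exp(−Σ_{j∈F_{n_k}} ψ(T^j x)), where P^{F}(x) := ⋂_{j∈F} T^{−j}(P(T^j x)) and P(y) denotes the element of P containing y. Set μ_{n_k} := η(· ∩ A_{n_k})/η(A_{n_k}). Then every weak* cluster point μ of the sequence μ_{n_k}^{F_{n_k}} := (1/#F_{n_k}) Σ_{j∈F_{n_k}} T^j_* μ_{n_k} satisfies h(μ) ≥ ∫ ψ dμ, where h denotes Kolmogorov–Sinai entropy with respect to T. -/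
open MeasureTheory Filter Topology Set
open scoped ENNReal NNReal Classical

noncomputable section


/-- `E ∩ {0, …, n-1}` as a finset. -/
def sec (E : Set ℕ) (n : ℕ) : Finset ℕ := (Finset.range n).filter (· ∈ E)

/-- `#(E ∩ {0, …, n-1})`. -/
def secCard (E : Set ℕ) (n : ℕ) : ℕ := (sec E n).card

/-- The boundary `∂E` of a set of integers: the points of `E` one of whose neighbours
(in `ℤ`) lies outside of `E`. -/
def bdry (E : Set ℕ) : Set ℕ := {k | k ∈ E ∧ ((k + 1) ∉ E ∨ k = 0 ∨ (k - 1) ∉ E)}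

/-- The upper asymptotic density of `E` along the subsequence `(n_k)`. -/
def upDensAlong (E : Set ℕ) (nk : ℕ → ℕ) : ℝ :=
  Filter.limsup (fun k => (secCard E (nk k) : ℝ) / (nk k : ℝ)) Filter.atTop

/-- The lower asymptotic density of `E` along the subsequence `(n_k)`. -/
def loDensAlong (E : Set ℕ) (nk : ℕ → ℕ) : ℝ :=
  Filter.liminf (fun k => (secCard E (nk k) : ℝ) / (nk k : ℝ)) Filter.atTop

/-- The upper asymptotic density of `E`. -/
def upDens (E : Set ℕ) : ℝ :=
  Filter.limsup (fun n => (secCard E n : ℝ) / (n : ℝ)) Filter.atTop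

/-- `F` is Fölner along `(n_k)`: its boundary has zero upper asymptotic density along
`(n_k)`. -/
def FolnerAlong (F : Set ℕ) (nk : ℕ → ℕ) : Prop := upDensAlong (bdry F) nk = 0

/-- `Fill^N(E)`: the union of all integer intervals `[a, b)` with `a, b ∈ E` and
`0 < b - a ≤ N`. -/
def fill (N : ℕ) (E : Set ℕ) : Set ℕ :=
  {k | ∃ a ∈ E, ∃ b ∈ E, a ≤ k ∧ k < b ∧ a < b ∧ b - a ≤ N}

/-- The averaged push-forward measure `μ^{F_n} = (1/#F_n) ∑_{j ∈ F_n} T^j_* μ`. -/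
def avgMeas {X : Type*} [MeasurableSpace X] (T : X → X) (F : Set ℕ) (μ : Measure X)
    (n : ℕ) : Measure X :=
  ((secCard F n : ℝ≥0∞))⁻¹ • ∑ j ∈ sec F n, Measure.map (T^[j]) μ

/-- `ν` is a weak* cluster point of the sequence of measures `s`, i.e. the weak* limit of
a subsequence. -/
def WeakClusterPt {X : Type*} [MeasurableSpace X] [TopologicalSpace X]
    (ν : Measure X) (s : ℕ → Measure X) : Prop :=
  ∃ φ : ℕ → ℕ, StrictMono φ ∧
    ∀ g : C(X, ℝ), Tendsto (fun k => ∫ x, g x ∂(s (φ k))) atTop (𝓝 (∫ x, g x ∂ν))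


/-- `P` is a finite Borel partition of `X`. -/
def IsPartition {X : Type*} [MeasurableSpace X] (P : Finset (Set X)) : Prop :=
  (∀ A ∈ P, MeasurableSet A) ∧ (∀ A ∈ P, ∀ B ∈ P, A ≠ B → A ∩ B = ∅) ∧
    ⋃₀ (P : Set (Set X)) = Set.univ

/-- The entropy `H_μ(⋁_{i<n} T^{-i}P)` of the `n`-th dynamical refinement of `P`. -/
def refEnt {X : Type*} [MeasurableSpace X] (μ : Measure X) (T : X → X)
    (P : Finset (Set X)) (n : ℕ) : ℝ :=
  ∑ c : Fin n → {A : Set X // A ∈ P},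
    Real.negMulLog ((μ (⋂ i : Fin n, (T^[(i : ℕ)]) ⁻¹' (c i : Set X))).toReal)

/-- The Kolmogorov–Sinai entropy of `(T, μ)`: the supremum over finite Borel partitions `P`
of `lim_n (1/n) H_μ(⋁_{i=0}^{n-1} T^{-i}P)`. -/
def ksEntropy {X : Type*} [MeasurableSpace X] (μ : Measure X) (T : X → X) : ℝ≥0∞ :=
  ⨆ P : {P : Finset (Set X) // IsPartition P},
    ENNReal.ofReal (Filter.liminf (fun n : ℕ => refEnt μ T P.1 n / n) Filter.atTop)

/-- The element of the partition `P` containing `y`. -/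
def partCell {X : Type*} (P : Finset (Set X)) (y : X) : Set X :=
  ⋃₀ {A : Set X | A ∈ P ∧ y ∈ A}

/-- The dynamical cell `P^F(x) = ⋂_{j ∈ F} T^{-j} P(T^j x)`. -/
def dynCell {X : Type*} (T : X → X) (P : Finset (Set X)) (Fs : Finset ℕ) (x : X) : Set X :=
  ⋂ j ∈ Fs, (T^[j]) ⁻¹' (partCell P (T^[j] x))


set_option linter.unusedSectionVars false

/-! ### Finite entropy -/

/-- Entropy of a finite-valued map. -/
def fEnt {X ι : Type*} [MeasurableSpace X] [Fintype ι] (μ : Measure X) (f : X → ι) : ℝ :=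
  ∑ a, Real.negMulLog (μ.real (f ⁻¹' {a}))

/-- Measurable fibres. -/
def MF {X ι : Type*} [MeasurableSpace X] (f : X → ι) : Prop :=
  ∀ s : Set ι, MeasurableSet (f ⁻¹' s)

lemma gibbs_ineq {ι : Type*} [Fintype ι] (p q : ι → ℝ) (hp : ∀ a, 0 ≤ p a) (hq : ∀ a, 0 ≤ q a)
    (hp1 : ∑ a, p a = 1) (hq1 : ∑ a, q a ≤ 1) (hpq : ∀ a, q a = 0 → p a = 0) :
    ∑ a, Real.negMulLog (p a) ≤ -∑ a, p a * Real.log (q a) := by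
  have key : ∀ a, Real.negMulLog (p a) + p a * Real.log (q a) ≤ q a - p a := by
    intro a
    rcases (hp a).eq_or_lt with h | h
    · simp [← h, hq a]
    · have hq' : 0 < q a := lt_of_le_of_ne (hq a) (fun h' => h.ne' (hpq a h'.symm))
      have := Real.log_le_sub_one_of_pos (div_pos hq' h)
      rw [Real.log_div hq'.ne' h.ne'] at this
      have h2 := mul_le_mul_of_nonneg_left this h.le
      have h3 : p a * (q a / p a - 1) = q a - p a := by field_simp
      rw [Real.negMulLog]
      linarith
  have := Finset.sum_le_sum (fun a (_ : a ∈ Finset.univ) => key a)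
  rw [Finset.sum_add_distrib, Finset.sum_sub_distrib] at this
  linarith

section ent
variable {X ι κ κ' : Type*} [MeasurableSpace X] [Fintype ι] [Fintype κ] [Fintype κ']
  {μ : Measure X} [IsProbabilityMeasure μ] {f : X → ι}

lemma MF.comp' {f : X → ι} (hf : MF f) (φ : ι → κ) : MF (φ ∘ f) := fun s => by
  rw [Set.preimage_comp]; exact hf _

lemma real_marg (hf : MF f) (φ : ι → κ) (b : κ) :
    μ.real ((φ ∘ f) ⁻¹' {b}) = ∑ a with φ a = b, μ.real (f ⁻¹' {a}) := by
  rw [← measureReal_biUnion_finset]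
  · congr 1
    ext x
    simp
  · intro a _ a' _ h
    exact Disjoint.preimage _ (by simpa using h)
  · intro a _; exact hf _

lemma sum_marg (hf : MF f) (φ : ι → κ) (w : κ → ℝ) :
    ∑ b, μ.real ((φ ∘ f) ⁻¹' {b}) * w b = ∑ a, μ.real (f ⁻¹' {a}) * w (φ a) := by
  rw [← Finset.sum_fiberwise (s := Finset.univ) (g := φ)]
  refine Finset.sum_congr rfl fun b _ => ?_
  rw [real_marg hf, Finset.sum_mul]
  refine Finset.sum_congr rfl fun a ha => ?_
  simp at ha
  rw [ha]

lemma sum_real (hf : MF f) : ∑ a, μ.real (f ⁻¹' {a}) = 1 := by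
  have := sum_marg (μ := μ) hf (fun _ => ()) (fun _ => 1)
  simp at this
  rw [← this]
  have : (((fun _ => ()) : ι → Unit) ∘ f) ⁻¹' {()} = Set.univ := by ext; simp
  rw [this]; simp

lemma real_le_marg (φ : ι → κ) (a : ι) :
    μ.real (f ⁻¹' {a}) ≤ μ.real ((φ ∘ f) ⁻¹' {φ a}) :=
  measureReal_mono (by intro x hx; simp at hx; simp [hx])

lemma fEnt_nonneg : 0 ≤ fEnt μ f :=
  Finset.sum_nonneg fun _ _ => Real.negMulLog_nonneg measureReal_nonneg measureReal_le_one

lemma fEnt_marg (hf : MF f) (φ : ι → κ) :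
    fEnt μ (φ ∘ f) = -∑ a, μ.real (f ⁻¹' {a}) * Real.log (μ.real ((φ ∘ f) ⁻¹' {φ a})) := by
  rw [← sum_marg hf φ (fun b => Real.log (μ.real ((φ ∘ f) ⁻¹' {b}))), fEnt, ← Finset.sum_neg_distrib]
  refine Finset.sum_congr rfl fun b _ => ?_
  rw [Real.negMulLog]; ring

lemma fEnt_comp_le (hf : MF f) (φ : ι → κ) : fEnt μ (φ ∘ f) ≤ fEnt μ f := by
  rw [fEnt_marg hf, fEnt, ← Finset.sum_neg_distrib]
  refine Finset.sum_le_sum fun a _ => ?_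
  rw [Real.negMulLog]
  rcases (measureReal_nonneg (μ := μ) (s := f ⁻¹' {a})).eq_or_lt with h | h
  · simp [← h]
  · have := Real.log_le_log h (real_le_marg (μ := μ) φ a)
    nlinarith

lemma fEnt_pair_le (hf : MF f) (φ : ι → κ) (χ : ι → κ')
    (hinj : ∀ a b, φ a = φ b → χ a = χ b → a = b) :
    fEnt μ f ≤ fEnt μ (φ ∘ f) + fEnt μ (χ ∘ f) := by
  rw [fEnt_marg hf φ, fEnt_marg hf χ]
  have := gibbs_ineq (fun a => μ.real (f ⁻¹' {a}))
    (fun a => μ.real ((φ ∘ f) ⁻¹' {φ a}) * μ.real ((χ ∘ f) ⁻¹' {χ a}))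
    (fun a => measureReal_nonneg) (fun a => mul_nonneg measureReal_nonneg measureReal_nonneg)
    (sum_real hf) ?_ ?_
  · refine this.trans ?_
    rw [← neg_add, ← Finset.sum_add_distrib]
    apply le_of_eq
    congr 1
    refine Finset.sum_congr rfl fun a _ => ?_
    rcases (measureReal_nonneg (μ := μ) (s := f ⁻¹' {a})).eq_or_lt with h | h
    · simp [← h]
    · rw [Real.log_mul (h.trans_le (real_le_marg φ a)).ne' (h.trans_le (real_le_marg χ a)).ne']
      ring
  · have h1 : ∑ z : κ × κ', μ.real ((φ ∘ f) ⁻¹' {z.1}) * μ.real ((χ ∘ f) ⁻¹' {z.2}) = 1 := by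
      rw [Fintype.sum_prod_type]
      simp_rw [← Finset.mul_sum]
      rw [sum_real (hf.comp' χ)]
      simp only [mul_one]
      rw [sum_real (hf.comp' φ)]
    rw [← h1]
    have hi : Function.Injective (fun a => (φ a, χ a)) := by
      intro a b h
      simp at h
      exact hinj a b h.1 h.2
    rw [← Finset.sum_image (s := Finset.univ) (g := fun a => (φ a, χ a))
      (f := fun z => μ.real ((φ ∘ f) ⁻¹' {z.1}) * μ.real ((χ ∘ f) ⁻¹' {z.2})) (hi.injOn)]
    exact Finset.sum_le_sum_of_subset_of_nonneg (Finset.subset_univ _)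
      fun _ _ _ => mul_nonneg measureReal_nonneg measureReal_nonneg
  · intro a h
    apply le_antisymm _ measureReal_nonneg
    rcases mul_eq_zero.1 h with h | h
    · rw [← h]; exact real_le_marg φ a
    · rw [← h]; exact real_le_marg χ a

lemma fEnt_le_log (hf : MF f) : fEnt μ f ≤ Real.log (Fintype.card ι) := by
  have hne : Nonempty X := by
    by_contra h
    rw [not_nonempty_iff] at h
    have := measure_univ (μ := μ)
    rw [Set.univ_eq_empty_iff.2 h] at this
    simp at this
  have hι : Nonempty ι := hne.map f
  have hc : (0:ℝ) < Fintype.card ι := by exact_mod_cast Fintype.card_pos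
  have := gibbs_ineq (fun a => μ.real (f ⁻¹' {a})) (fun _ => (Fintype.card ι : ℝ)⁻¹)
    (fun a => measureReal_nonneg) (fun a => by positivity)
    (sum_real hf) (by simp [hc.ne']) (by intro a h; simp at h)
  refine this.trans (le_of_eq ?_)
  rw [← Finset.sum_mul, sum_real hf, Real.log_inv]
  ring

end ent

/-- The itinerary of a point along `S`. -/
def tup {X ι : Type*} (c : X → ι) (T : X → X) (S : Finset ℕ) (x : X) : S → ι :=
  fun j => c (T^[(j : ℕ)] x)

/-- The itinerary of a point along an interval. -/
def win {X ι : Type*} (c : X → ι) (T : X → X) (i m : ℕ) (x : X) : Fin m → ι :=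
  fun j => c (T^[i + (j : ℕ)] x)

section tups
variable {X ι : Type*} [MeasurableSpace X] [Fintype ι]
  {μ : Measure X} [IsProbabilityMeasure μ] {c : X → ι} {T : X → X}

lemma MF_pi {α : Type*} [Fintype α] {g : X → α → ι} (h : ∀ j, MF (fun x => g x j)) : MF g := by
  intro s
  have : g ⁻¹' s = ⋃ a ∈ s, ⋂ j, (fun x => g x j) ⁻¹' {a j} := by
    ext x
    simp only [Set.mem_preimage, Set.mem_iUnion, Set.mem_iInter, Set.mem_singleton_iff]
    constructor
    · intro hx; exact ⟨g x, hx, fun j => rfl⟩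
    · rintro ⟨a, ha, h⟩
      have : g x = a := funext h
      rwa [this]
  rw [this]
  exact MeasurableSet.biUnion (Set.to_countable s) fun a _ => MeasurableSet.iInter fun j => h j _

lemma MF_iter (hc : MF c) (hT : Measurable T) (n : ℕ) : MF (fun x => c (T^[n] x)) := by
  intro s
  exact (hT.iterate n) (hc s)

lemma MF_tup (hc : MF c) (hT : Measurable T) (S : Finset ℕ) : MF (tup c T S) :=
  MF_pi fun _ => MF_iter hc hT _

lemma MF_win (hc : MF c) (hT : Measurable T) (i m : ℕ) : MF (win c T i m) :=
  MF_pi fun _ => MF_iter hc hT _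

lemma tup_mono (hc : MF c) (hT : Measurable T) {S S' : Finset ℕ} (h : S ⊆ S') :
    fEnt μ (tup c T S) ≤ fEnt μ (tup c T S') :=
  fEnt_comp_le (MF_tup hc hT S') (fun a (j : S) => a ⟨j, h j.2⟩)

lemma tup_le_win (hc : MF c) (hT : Measurable T) {S : Finset ℕ} {i m : ℕ}
    (h : ∀ j ∈ S, i ≤ j ∧ j < i + m) :
    fEnt μ (tup c T S) ≤ fEnt μ (win c T i m) := by
  have := fEnt_comp_le (μ := μ) (MF_win hc hT i m)
    (fun a (j : S) => a ⟨j - i, by have := h j j.2; omega⟩)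
  convert this using 2
  ext x j
  simp only [tup, win, Function.comp]
  rw [Nat.add_sub_cancel' (h j j.2).1]

lemma tup_union (hc : MF c) (hT : Measurable T) (S S' : Finset ℕ) :
    fEnt μ (tup c T (S ∪ S')) ≤ fEnt μ (tup c T S) + fEnt μ (tup c T S') := by
  refine fEnt_pair_le (MF_tup hc hT _) (fun a (j : S) => a ⟨j, Finset.mem_union_left _ j.2⟩)
    (fun a (j : S') => a ⟨j, Finset.mem_union_right _ j.2⟩) ?_
  intro a b h1 h2
  funext ⟨j, hj⟩
  rcases Finset.mem_union.1 hj with h | h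
  · exact congrFun h1 ⟨j, h⟩
  · exact congrFun h2 ⟨j, h⟩

lemma tup_le_card (hc : MF c) (hT : Measurable T) (S : Finset ℕ) :
    fEnt μ (tup c T S) ≤ S.card * Real.log (Fintype.card ι) := by
  refine (fEnt_le_log (MF_tup hc hT S)).trans (le_of_eq ?_)
  simp

lemma tup_biUnion (hc : MF c) (hT : Measurable T) (s : Finset ℕ) (W : ℕ → Finset ℕ) :
    fEnt μ (tup c T (s.biUnion W)) ≤ ∑ t ∈ s, fEnt μ (tup c T (W t)) := by
  induction s using Finset.induction_on with
  | empty => exact (tup_le_card (μ := μ) hc hT _).trans (by simp)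
  | insert a s ha ih =>
    rw [Finset.biUnion_insert, Finset.sum_insert ha]
    exact (tup_union hc hT _ _).trans (by linarith)

/-- The windows `F_n ∩ [t - m, t)`. -/
def wnd (S : Finset ℕ) (m t : ℕ) : Finset ℕ := S.filter (fun j => t ≤ j + m ∧ j < t)

lemma shearer (hc : MF c) (hT : Measurable T) (F : Set ℕ) (n m : ℕ) (hm : 0 < m) :
    m * fEnt μ (tup c T (sec F n)) ≤
      ∑ i ∈ sec F n, fEnt μ (win c T i m)
        + m * (secCard (bdry F) n) * (m * Real.log (Fintype.card ι)) := by
  have hX : Nonempty X := by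
    by_contra h
    rw [not_nonempty_iff] at h
    have := measure_univ (μ := μ)
    rw [Set.univ_eq_empty_iff.2 h] at this
    simp at this
  have hL : 0 ≤ Real.log (Fintype.card ι) := Real.log_natCast_nonneg _
  have h1 : m * fEnt μ (tup c T (sec F n)) ≤
      ∑ t ∈ Finset.range (m + n), fEnt μ (tup c T (wnd (sec F n) m t)) := by
    rw [← Finset.sum_fiberwise_of_maps_to (s := Finset.range (m + n)) (t := Finset.range m)
      (g := fun t => t % m) (fun t _ => by simpa using Nat.mod_lt t hm)]
    have : (m : ℝ) * fEnt μ (tup c T (sec F n)) =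
        ∑ r ∈ Finset.range m, fEnt μ (tup c T (sec F n)) := by simp
    rw [this]
    refine Finset.sum_le_sum fun r hr => ?_
    refine le_trans (tup_mono hc hT ?_) (tup_biUnion hc hT _ _)
    intro j hj
    have hr' := Finset.mem_range.1 hr
    have hjn : j < n := by simp [sec] at hj; exact hj.1
    rw [Finset.mem_biUnion]
    have hd := Nat.mod_lt (j + m - r) hm
    have hdm := Nat.div_add_mod (j + m - r) m
    refine ⟨r + m * ((j + m - r) / m), ?_, ?_⟩
    · simp only [Finset.mem_filter, Finset.mem_range, Nat.add_mul_mod_self_left]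
      exact ⟨by omega, Nat.mod_eq_of_lt hr'⟩
    · simp only [wnd, Finset.mem_filter]
      exact ⟨hj, by omega, by omega⟩
  refine h1.trans ?_
  let bad : Finset ℕ := (sec (bdry F) n).biUnion (fun b => Finset.Ioc b (b + m))
  have h2 : ∀ t ∈ Finset.range (m + n), fEnt μ (tup c T (wnd (sec F n) m t)) ≤
      (if m ≤ t ∧ t - m ∈ sec F n then fEnt μ (win c T (t - m) m) else 0) +
      (if t ∈ bad then m * Real.log (Fintype.card ι) else 0) := by
    intro t ht
    have hb0 : (0:ℝ) ≤ (if t ∈ bad then m * Real.log (Fintype.card ι) else 0) := by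
      split_ifs <;> positivity
    by_cases hg : m ≤ t ∧ t - m ∈ sec F n
    · rw [if_pos hg]
      have : fEnt μ (tup c T (wnd (sec F n) m t)) ≤ fEnt μ (win c T (t - m) m) := by
        apply tup_le_win hc hT
        intro j hj
        simp only [wnd, Finset.mem_filter] at hj
        omega
      linarith
    · rw [if_neg hg, zero_add]
      rcases (wnd (sec F n) m t).eq_empty_or_nonempty with he | he
      · rw [he]
        refine (tup_le_card hc hT _).trans ?_
        simpa using hb0
      · have hj := Finset.min'_mem _ he
        have hmin := Finset.min'_le (wnd (sec F n) m t)
        set j := (wnd (sec F n) m t).min' he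
        have hjW := hj
        simp only [wnd, Finset.mem_filter] at hj
        obtain ⟨hjF, h3, h4⟩ := hj
        have hjF' := hjF
        simp only [sec, Finset.mem_filter, Finset.mem_range] at hjF'
        have hbad : t ∈ bad := by
          simp only [bad, Finset.mem_biUnion, Finset.mem_Ioc]
          refine ⟨j, ?_, h4, h3⟩
          refine Finset.mem_filter.2 ⟨Finset.mem_range.2 hjF'.1, hjF'.2, ?_⟩
          right
          by_cases hj0 : j = 0
          · exact Or.inl hj0
          · right
            intro hj1
            have hne : t ≠ j + m := by
              intro h
              apply hg
              refine ⟨by omega, ?_⟩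
              rw [h, Nat.add_sub_cancel]; exact hjF
            have := hmin (j - 1) (Finset.mem_filter.2 ⟨by
              simp only [sec, Finset.mem_filter, Finset.mem_range]
              exact ⟨by omega, hj1⟩, by omega, by omega⟩)
            omega
        rw [if_pos hbad]
        refine (tup_le_card hc hT _).trans ?_
        apply mul_le_mul_of_nonneg_right _ hL
        have : (wnd (sec F n) m t) ⊆ Finset.Ico (t - m) t := by
          intro x hx
          simp only [wnd, Finset.mem_filter] at hx
          simp; omega
        have := Finset.card_le_card this
        rw [Nat.card_Ico] at this
        exact_mod_cast (by omega : (wnd (sec F n) m t).card ≤ m)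
  refine (Finset.sum_le_sum h2).trans ?_
  rw [Finset.sum_add_distrib]
  apply add_le_add
  · rw [Finset.sum_range_add]
    have hz : ∑ t ∈ Finset.range m, (if m ≤ t ∧ t - m ∈ sec F n then fEnt μ (win c T (t - m) m) else 0) = 0 := by
      apply Finset.sum_eq_zero
      intro t ht
      rw [if_neg]
      simp at ht; omega
    rw [hz, zero_add, ← Finset.sum_filter]
    simp only [Nat.le_add_right, true_and, Nat.add_sub_cancel_left]
    apply le_of_eq
    apply Finset.sum_congr _ (fun _ _ => rfl)
    ext i
    simp only [sec, Finset.mem_filter, Finset.mem_range]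
    tauto
  · rw [← Finset.sum_filter, Finset.sum_const, nsmul_eq_mul]
    apply mul_le_mul_of_nonneg_right _ (by positivity)
    have : ((Finset.range (m + n)).filter (· ∈ bad)).card ≤ m * secCard (bdry F) n := by
      refine (Finset.card_le_card (t := bad) (fun x hx => (Finset.mem_filter.1 hx).2)).trans ?_
      refine (Finset.card_biUnion_le).trans ?_
      simp [secCard, mul_comm]
    exact_mod_cast this

end tups

/-! ### Partitions -/

section parts
variable {X : Type*} [MeasurableSpace X]

lemma exists_cell {P : Finset (Set X)} (hP : IsPartition P) :
    ∃ c : X → {A : Set X // A ∈ P}, ∀ x A, c x = A ↔ x ∈ A.1 := by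
  have h : ∀ x : X, ∃ A : {A : Set X // A ∈ P}, x ∈ A.1 := by
    intro x
    have : x ∈ ⋃₀ (P : Set (Set X)) := by rw [hP.2.2]; trivial
    obtain ⟨A, hA, hx⟩ := this
    exact ⟨⟨A, hA⟩, hx⟩
  choose c hc using h
  refine ⟨c, fun x A => ⟨fun h => h ▸ hc x, fun h => ?_⟩⟩
  by_contra hne
  have := hP.2.1 (c x).1 (c x).2 A.1 A.2 (fun h => hne (Subtype.ext h))
  have hx : x ∈ (c x).1 ∩ A.1 := ⟨hc x, h⟩
  rw [this] at hx
  exact hx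

lemma MF_cell {P : Finset (Set X)} (hP : IsPartition P) {c : X → {A : Set X // A ∈ P}}
    (hc : ∀ x A, c x = A ↔ x ∈ A.1) : MF c := by
  intro s
  have : c ⁻¹' s = ⋃ A ∈ s, A.1 := by
    ext x
    simp only [Set.mem_preimage, Set.mem_iUnion]
    constructor
    · intro h; exact ⟨c x, h, (hc x _).1 rfl⟩
    · rintro ⟨A, hA, hx⟩
      rw [(hc x A).2 hx]; exact hA
  rw [this]
  exact MeasurableSet.biUnion (Set.to_countable s) fun A _ => hP.1 A.1 A.2

lemma partCell_eq {P : Finset (Set X)} {c : X → {A : Set X // A ∈ P}}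
    (hc : ∀ x A, c x = A ↔ x ∈ A.1) (y : X) : partCell P y = (c y).1 := by
  ext z
  unfold partCell
  constructor
  · rintro ⟨A, ⟨hA, hy⟩, hz⟩
    rw [(hc y ⟨A, hA⟩).2 hy]; exact hz
  · intro hz
    exact ⟨(c y).1, ⟨(c y).2, (hc y _).1 rfl⟩, hz⟩

lemma dynCell_eq {P : Finset (Set X)} {c : X → {A : Set X // A ∈ P}}
    (hc : ∀ x A, c x = A ↔ x ∈ A.1) (T : X → X) (S : Finset ℕ) (x : X) :
    dynCell T P S x = tup c T S ⁻¹' {tup c T S x} := by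
  ext z
  simp only [dynCell, Set.mem_iInter, Set.mem_preimage, partCell_eq hc, ← hc,
    Set.mem_singleton_iff, funext_iff, tup, Subtype.forall]

lemma refEnt_eq {P : Finset (Set X)} {c : X → {A : Set X // A ∈ P}}
    (hc : ∀ x A, c x = A ↔ x ∈ A.1) (T : X → X) (m : ℕ) (μ : Measure X) :
    refEnt μ T P m = fEnt μ (win c T 0 m) := by
  unfold refEnt fEnt
  refine Finset.sum_congr rfl fun a _ => ?_
  congr 2
  congr 1
  ext z
  simp only [Set.mem_iInter, Set.mem_preimage, ← hc, Set.mem_singleton_iff, funext_iff, win,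
    zero_add]

lemma win_map {ι : Type*} [Fintype ι] {c : X → ι} (hc : MF c) {T : X → X} (hT : Measurable T)
    (i m : ℕ) (μ : Measure X) :
    fEnt (μ.map (T^[i])) (win c T 0 m) = fEnt μ (win c T i m) := by
  unfold fEnt
  refine Finset.sum_congr rfl fun a _ => ?_
  rw [map_measureReal_apply (hT.iterate i) (MF_win hc hT 0 m _), ← Set.preimage_comp]
  congr 3
  ext x j
  simp only [win, Function.comp, zero_add]
  rw [add_comm, Function.iterate_add_apply]

lemma avg_real {T : X → X} (F : Set ℕ) (μ : Measure X) [IsFiniteMeasure μ] (n : ℕ)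
    (s : Set X) :
    (avgMeas T F μ n).real s =
      ∑ j ∈ sec F n, ((secCard F n : ℝ))⁻¹ • (μ.map (T^[j])).real s := by
  unfold avgMeas
  rw [measureReal_ennreal_smul_apply, ← Finset.smul_sum]
  simp [Measure.real, ENNReal.toReal_sum]

lemma avg_prob {T : X → X} (hT : Measurable T) (F : Set ℕ) (μ : Measure X)
    [IsProbabilityMeasure μ] (n : ℕ) (hn : 0 < secCard F n) :
    IsProbabilityMeasure (avgMeas T F μ n) := by
  constructor
  have : ∀ j, IsProbabilityMeasure (μ.map (T^[j])) := fun j =>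
    Measure.isProbabilityMeasure_map (hT.iterate j).aemeasurable
  unfold avgMeas
  simp only [Measure.smul_apply, Measure.finsetSum_apply, measure_univ, Finset.sum_const,
    smul_eq_mul, nsmul_eq_mul, mul_one]
  exact ENNReal.inv_mul_cancel (by simpa [secCard] using hn.ne') (by simp [secCard])

lemma avg_integral {T : X → X} (hT : Measurable T) (F : Set ℕ) (μ : Measure X)
    [IsProbabilityMeasure μ] (n : ℕ) (g : X → ℝ) (hg : Measurable g)
    (hi : ∀ j, Integrable (fun x => g (T^[j] x)) μ) :
    ∫ x, g x ∂(avgMeas T F μ n) = (secCard F n : ℝ)⁻¹ * ∫ x, ∑ j ∈ sec F n, g (T^[j] x) ∂μ := by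
  unfold avgMeas
  rw [integral_smul_measure, integral_finsetSum_measure, integral_finsetSum _ (fun j _ => hi j)]
  · simp only [ENNReal.toReal_inv, ENNReal.toReal_natCast, smul_eq_mul]
    congr 1
    refine Finset.sum_congr rfl fun j _ => ?_
    rw [integral_map (hT.iterate j).aemeasurable hg.aestronglyMeasurable]
  · intro j _
    rw [integrable_map_measure hg.aestronglyMeasurable (hT.iterate j).aemeasurable]
    exact hi j

lemma concave_avg {ι : Type*} [Fintype ι] {c : X → ι} (hc : MF c) {T : X → X}
    (hT : Measurable T) (F : Set ℕ) (μ : Measure X) [IsProbabilityMeasure μ] (n m : ℕ)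
    (hn : 0 < secCard F n) :
    ∑ i ∈ sec F n, fEnt μ (win c T i m) ≤
      secCard F n * fEnt (avgMeas T F μ n) (win c T 0 m) := by
  have hn' : (0:ℝ) < secCard F n := by exact_mod_cast hn
  rw [← inv_mul_le_iff₀ hn']
  rw [Finset.sum_congr rfl (fun i _ => (win_map hc hT i m μ).symm)]
  unfold fEnt
  rw [Finset.sum_comm, Finset.mul_sum]
  refine Finset.sum_le_sum fun a _ => ?_
  rw [avg_real, Finset.mul_sum]
  refine Real.concaveOn_negMulLog.le_map_sum (w := fun _ => (secCard F n : ℝ)⁻¹)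
    (fun _ _ => by positivity) ?_ (fun _ _ => measureReal_nonneg)
  rw [Finset.sum_const, nsmul_eq_mul]
  exact mul_inv_cancel₀ hn'.ne'

lemma gibbs_lower {ι : Type*} [Fintype ι] {f : X → ι} (hf : MF f)
    (η : Measure X) [IsProbabilityMeasure η] (A : Set X) (hA : MeasurableSet A) (hA0 : 0 < η A)
    (G : X → ℝ) (hG : Integrable G ((η A)⁻¹ • η.restrict A))
    (h : ∀ x ∈ A, η (f ⁻¹' {f x} ∩ A) ≤ ENNReal.ofReal (Real.exp (-G x))) :
    ∫ x, G x ∂((η A)⁻¹ • η.restrict A) + Real.log (η A).toReal ≤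
      fEnt ((η A)⁻¹ • η.restrict A) f := by
  set μ := (η A)⁻¹ • η.restrict A with hμ
  have hprob : IsProbabilityMeasure μ := by
    constructor
    simp [hμ, ENNReal.inv_mul_cancel hA0.ne' (measure_ne_top η A)]
  have hae : ∀ᵐ x ∂μ, x ∈ A := by
    apply Measure.ae_smul_measure
    exact ae_restrict_mem hA
  have hApos : 0 < (η A).toReal := ENNReal.toReal_pos hA0.ne' (measure_ne_top _ _)
  have hun : (⋃ a, f ⁻¹' {a}) = Set.univ := by ext; simp
  have hsplit : ∫ x, G x ∂μ = ∑ a, ∫ x in f ⁻¹' {a}, G x ∂μ := by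
    rw [← integral_iUnion_fintype (fun a => hf _) _ (fun a => hG.integrableOn), hun,
      Measure.restrict_univ]
    intro a b hab
    exact Disjoint.preimage _ (by simpa using hab)
  have hone : Real.log (η A).toReal = ∑ a, μ.real (f ⁻¹' {a}) * Real.log (η A).toReal := by
    rw [← Finset.sum_mul, sum_real hf, one_mul]
  rw [hsplit, hone, ← Finset.sum_add_distrib, fEnt]
  refine Finset.sum_le_sum fun a _ => ?_
  rcases (measureReal_nonneg (μ := μ) (s := f ⁻¹' {a})).eq_or_lt with h0 | h0
  · have : μ (f ⁻¹' {a}) = 0 := by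
      rw [eq_comm, measureReal_eq_zero_iff] at h0
      exact h0
    rw [← h0, Measure.restrict_eq_zero.2 this]
    simp
  · have hval : (η (f ⁻¹' {a} ∩ A)).toReal = μ.real (f ⁻¹' {a}) * (η A).toReal := by
      rw [hμ, measureReal_ennreal_smul_apply, measureReal_restrict_apply (hf _),
        ENNReal.toReal_inv, Measure.real]
      field_simp
    have hle : ∀ᵐ x ∂(μ.restrict (f ⁻¹' {a})),
        G x ≤ -Real.log (μ.real (f ⁻¹' {a})) - Real.log (η A).toReal := by
      filter_upwards [ae_restrict_mem (hf {a}), ae_restrict_of_ae hae] with x hx hxA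
      have hx' : f x = a := hx
      have h1 := h x hxA
      rw [hx'] at h1
      have h2 := ENNReal.toReal_mono ENNReal.ofReal_ne_top h1
      rw [ENNReal.toReal_ofReal (Real.exp_pos _).le, hval] at h2
      have h3 := Real.log_le_log (mul_pos h0 hApos) h2
      rw [Real.log_exp, Real.log_mul h0.ne' hApos.ne'] at h3
      linarith
    have h4 := integral_mono_ae (μ := μ.restrict (f ⁻¹' {a})) hG.integrableOn
      (integrable_const _) hle
    rw [setIntegral_const, smul_eq_mul] at h4
    rw [Real.negMulLog]
    nlinarith

end parts

section bd
variable {X : Type*} [MetricSpace X] [CompactSpace X] [MeasurableSpace X] [BorelSpace X]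

lemma null_frontier_diff (ρ : Measure X) {s t : Set X} (hs : ρ (frontier s) = 0)
    (ht : ρ (frontier t) = 0) : ρ (frontier (s \ t)) = 0 := by
  have h : frontier (s \ t) ⊆ frontier s ∪ frontier t := by
    rw [Set.sdiff_eq]
    refine (frontier_inter_subset _ _).trans ?_
    rw [frontier_compl]
    exact Set.union_subset_union Set.inter_subset_left Set.inter_subset_right
  exact measure_mono_null h (measure_union_null hs ht)

lemma exists_partition (ρ : Measure X) [SFinite ρ] (ε : ℝ) (hε : 0 < ε) :
    ∃ P : Finset (Set X), IsPartition P ∧ (∀ s ∈ P, Metric.diam s < ε) ∧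
      ∀ s ∈ P, ρ (frontier s) = 0 := by
  have h : ∀ x : X, ∃ r, r ∈ Set.Ioo 0 (ε / 3) ∧ ρ (frontier (Metric.ball x r)) = 0 := by
    intro x
    obtain ⟨r, hr, h⟩ := exists_null_frontier_thickening ρ {x} (a := 0) (b := ε / 3) (by positivity)
    rw [Metric.thickening_singleton] at h
    exact ⟨r, hr, h⟩
  choose r hr hρ using h
  obtain ⟨t, ht⟩ := isCompact_univ.elim_finite_subcover (fun x : X => Metric.ball x (r x))
    (fun x => Metric.isOpen_ball) (fun x _ => Set.mem_iUnion.2 ⟨x, by simpa using (hr x).1⟩)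
  let e := t.equivFin
  let B : Fin t.card → Set X := fun i => Metric.ball (e.symm i : X) (r (e.symm i))
  have hcov : (⋃ i, disjointed B i) = Set.univ := by
    rw [iUnion_disjointed]
    apply Set.eq_univ_of_univ_subset
    refine ht.trans ?_
    intro y hy
    simp only [Set.mem_iUnion] at hy ⊢
    obtain ⟨x, hx, hy⟩ := hy
    exact ⟨e ⟨x, hx⟩, by simpa [B] using hy⟩
  refine ⟨Finset.univ.image (disjointed B), ⟨?_, ?_, ?_⟩, ?_, ?_⟩
  · intro s hs
    obtain ⟨i, _, rfl⟩ := Finset.mem_image.1 hs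
    refine disjointedRec (p := fun s => MeasurableSet s) (fun u j hu => ?_) ?_
    · exact hu.diff Metric.isOpen_ball.measurableSet
    · exact Metric.isOpen_ball.measurableSet
  · intro s hs u hu hne
    obtain ⟨i, _, rfl⟩ := Finset.mem_image.1 hs
    obtain ⟨j, _, rfl⟩ := Finset.mem_image.1 hu
    exact Set.disjoint_iff_inter_eq_empty.1
      (disjoint_disjointed B (fun h : i = j => hne (by rw [h])))
  · rw [← hcov]
    simp
  · intro s hs
    obtain ⟨i, _, rfl⟩ := Finset.mem_image.1 hs
    have h1 : Metric.diam (disjointed B i) ≤ 2 * r (e.symm i) :=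
      (Metric.diam_mono (disjointed_subset B i) Metric.isBounded_ball).trans
        (Metric.diam_ball (hr _).1.le)
    have := (hr (e.symm i)).2
    linarith
  · intro s hs
    obtain ⟨i, _, rfl⟩ := Finset.mem_image.1 hs
    exact disjointedRec (p := fun s => ρ (frontier s) = 0)
      (fun u j hu => null_frontier_diff ρ hu (hρ _)) (hρ _)

lemma null_frontier_win (ν : Measure X) {T : X → X} (hT : Continuous T)
    {P : Finset (Set X)} {c : X → {A : Set X // A ∈ P}}
    (hc : ∀ x A, c x = A ↔ x ∈ A.1)
    (hP : ∀ s ∈ P, ∀ i, ν (T^[i] ⁻¹' (frontier s)) = 0) (m : ℕ) (a : Fin m → {A : Set X // A ∈ P}) :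
    ν (frontier (win c T 0 m ⁻¹' {a})) = 0 := by
  have h1 : win c T 0 m ⁻¹' {a} = ⋂ j ∈ (Finset.univ : Finset (Fin m)), T^[(j:ℕ)] ⁻¹' (a j).1 := by
    ext z
    simp only [Set.mem_iInter, Set.mem_preimage, ← hc, Set.mem_singleton_iff, funext_iff, win,
      zero_add, Finset.mem_univ, true_imp_iff]
  rw [h1]
  induction (Finset.univ : Finset (Fin m)) using Finset.induction_on with
  | empty => simp
  | insert j s _ ih =>
    rw [Finset.set_biInter_insert]
    refine measure_mono_null (t := T^[(j:ℕ)] ⁻¹' (frontier (a j).1) ∪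
      frontier (⋂ j ∈ s, T^[(j:ℕ)] ⁻¹' (a j).1)) ?_ (measure_union_null (hP _ (a j).2 _) ih)
    refine (frontier_inter_subset _ _).trans ?_
    refine Set.union_subset_union (Set.inter_subset_left.trans ?_) Set.inter_subset_right
    exact (hT.iterate j).frontier_preimage_subset _

end bd

lemma port {X : Type*} [MetricSpace X] [CompactSpace X] [MeasurableSpace X] [BorelSpace X]
    (s : ℕ → Measure X) (ν : Measure X) [IsFiniteMeasure ν]
    (hs : ∀ᶠ k in atTop, IsProbabilityMeasure (s k))
    (h : ∀ g : C(X, ℝ), Tendsto (fun k => ∫ x, g x ∂(s k)) atTop (𝓝 (∫ x, g x ∂ν))) :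
    IsProbabilityMeasure ν ∧ ∀ E, ν (frontier E) = 0 →
      Tendsto (fun k => (s k).real E) atTop (𝓝 (ν.real E)) := by
  have hν : IsProbabilityMeasure ν := by
    have h1 := h (ContinuousMap.const X 1)
    have h2 : Tendsto (fun k => ∫ x, (ContinuousMap.const X (1:ℝ)) x ∂(s k)) atTop (𝓝 1) := by
      apply tendsto_const_nhds.congr'
      filter_upwards [hs] with k hk
      simp
    have h3 := tendsto_nhds_unique h1 h2
    simp [Measure.real] at h3
    constructor
    rw [← ENNReal.toReal_eq_one_iff]
    exact h3
  refine ⟨hν, fun E hE => ?_⟩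
  obtain ⟨L, hL⟩ := eventually_atTop.1 hs
  let ms : ℕ → ProbabilityMeasure X := fun l => ⟨s (l + L), hL _ (by omega)⟩
  have hms : Tendsto ms atTop (𝓝 (⟨ν, hν⟩ : ProbabilityMeasure X)) := by
    refine ProbabilityMeasure.tendsto_iff_forall_integral_tendsto.2 ?_
    intro f
    exact (h f.toContinuousMap).comp (tendsto_add_atTop_nat L)
  have := ProbabilityMeasure.tendsto_measure_of_null_frontier_of_tendsto' hms (E := E) hE
  have h4 := (ENNReal.tendsto_toReal (measure_ne_top ν E)).comp this
  exact (tendsto_add_atTop_iff_nat (f := fun k => (s k).real E) L).1 h4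

lemma secCard_div_nonneg (E : Set ℕ) (n : ℕ) : (0:ℝ) ≤ (secCard E n : ℝ) / n := by positivity

lemma secCard_div_le (E : Set ℕ) (n : ℕ) : (secCard E n : ℝ) / n ≤ 1 := by
  apply div_le_one_of_le₀ _ (by positivity)
  have : secCard E n ≤ n := by
    unfold secCard sec
    exact (Finset.card_filter_le _ _).trans (by simp)
  exact_mod_cast this

lemma dens_pos {F : Set ℕ} {nk : ℕ → ℕ} (h : 0 < loDensAlong F nk) :
    ∃ c : ℝ, 0 < c ∧ ∀ᶠ k in atTop, c < (secCard F (nk k) : ℝ) / (nk k : ℝ) := by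
  refine ⟨loDensAlong F nk / 2, by positivity, ?_⟩
  exact eventually_lt_of_lt_liminf (half_lt_self h)
    (isBoundedUnder_of ⟨0, fun k => secCard_div_nonneg _ _⟩)

lemma folner_tendsto {F : Set ℕ} {nk : ℕ → ℕ} (h : FolnerAlong F nk) :
    Tendsto (fun k => (secCard (bdry F) (nk k) : ℝ) / (nk k : ℝ)) atTop (𝓝 0) := by
  have hb : IsBoundedUnder (· ≤ ·) atTop
      (fun k => (secCard (bdry F) (nk k) : ℝ) / (nk k : ℝ)) :=
    isBoundedUnder_of ⟨1, fun k => secCard_div_le _ _⟩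
  have hb' : IsBoundedUnder (· ≥ ·) atTop
      (fun k => (secCard (bdry F) (nk k) : ℝ) / (nk k : ℝ)) :=
    isBoundedUnder_of ⟨0, fun k => secCard_div_nonneg _ _⟩
  refine tendsto_of_le_liminf_of_limsup_le ?_ (le_of_eq h) hb hb'
  exact le_liminf_of_le hb.isCoboundedUnder_ge (Eventually.of_forall fun k => secCard_div_nonneg _ _)

lemma ratio_tendsto {F : Set ℕ} {nk : ℕ → ℕ} {c : ℝ} (hc : 0 < c)
    (hF : ∀ᶠ k in atTop, c < (secCard F (nk k) : ℝ) / (nk k : ℝ)) (u : ℕ → ℝ)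
    (hu : Tendsto (fun k => u k / (nk k : ℝ)) atTop (𝓝 0)) :
    Tendsto (fun k => u k / (secCard F (nk k) : ℝ)) atTop (𝓝 0) := by
  have h1 : Tendsto (fun k => |u k / (nk k : ℝ)| / c) atTop (𝓝 0) := by
    simpa using hu.abs.div_const c
  refine squeeze_zero_norm' ?_ h1
  filter_upwards [hF] with k hk
  have hn : (0:ℝ) < nk k := by
    rcases (Nat.cast_nonneg (α := ℝ) (nk k)).eq_or_lt with h | h
    · rw [← h] at hk; simp at hk; linarith
    · exact h
  rw [lt_div_iff₀ hn] at hk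
  rw [Real.norm_eq_abs, abs_div, abs_div, Nat.abs_cast, Nat.abs_cast, div_div]
  apply div_le_div_of_nonneg_left (abs_nonneg _) (by positivity)
  linarith

/-- (Fölner–Gibbs property forces an entropy lower bound for weak*
cluster points of the averaged conditional measures.) -/
theorem folner_gibbs_entropy {X : Type*} [MetricSpace X] [CompactSpace X]
    [MeasurableSpace X] [BorelSpace X]
    (T : X → X) (hT : Continuous T)
    (η : Measure X) (hη : IsProbabilityMeasure η)
    (ψ : X → ℝ) (hψ : Continuous ψ)
    (nk : ℕ → ℕ) (hnk : StrictMono nk)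
    (F : Set ℕ) (hFol : FolnerAlong F nk) (hdens : 0 < loDensAlong F nk)
    (A : ℕ → Set X) (hAmeas : ∀ k, MeasurableSet (A k)) (hApos : ∀ k, 0 < η (A k))
    (hAsub : Tendsto (fun k => Real.log ((η (A k)).toReal) / (nk k : ℝ)) atTop (𝓝 (0 : ℝ)))
    (hGibbs : ∃ ε : ℝ, 0 < ε ∧ ∀ P : Finset (Set X), IsPartition P →
      (∀ s ∈ P, Metric.diam s < ε) →
      ∃ N : ℕ, ∀ k : ℕ, N < nk k → ∀ x ∈ A k,
        η (dynCell T P (sec F (nk k)) x ∩ A k) ≤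
          ENNReal.ofReal (Real.exp (-(∑ j ∈ sec F (nk k), ψ (T^[j] x)))))
    (ν : Measure X) (hfin : IsFiniteMeasure ν)
    (hcl : WeakClusterPt ν
      (fun k => avgMeas T F ((η (A k))⁻¹ • η.restrict (A k)) (nk k))) :
    ENNReal.ofReal (∫ x, ψ x ∂ν) ≤ ksEntropy ν T := by
  obtain ⟨ε, hε, hG⟩ := hGibbs
  obtain ⟨φ, hφ, hconv⟩ := hcl
  have hTm : Measurable T := hT.measurable
  obtain ⟨c0, hc0, hF⟩ := dens_pos hdens
  have hFpos : ∀ᶠ k in atTop, 0 < secCard F (nk k) := by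
    filter_upwards [hF] with k hk
    rcases Nat.eq_zero_or_pos (secCard F (nk k)) with h | h
    · rw [h] at hk; simp at hk; linarith
    · exact h
  have hμ : ∀ k, IsProbabilityMeasure ((η (A k))⁻¹ • η.restrict (A k)) := by
    intro k
    constructor
    simp [ENNReal.inv_mul_cancel (hApos k).ne' (measure_ne_top η (A k))]
  have hφt := hφ.tendsto_atTop
  obtain ⟨hν, hport⟩ := port _ ν (by
    filter_upwards [hφt.eventually hFpos] with l hl
    exact avg_prob hTm F _ _ hl) hconv
  -- the partition
  obtain ⟨P, hP, hdiam, hfr⟩ := exists_partition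
    (Measure.sum fun i => ν.map (T^[i])) ε hε
  have hfr' : ∀ s ∈ P, ∀ i, ν (T^[i] ⁻¹' (frontier s)) = 0 := by
    intro s hs i
    have h1 := hfr s hs
    rw [Measure.sum_apply _ isClosed_frontier.measurableSet, ENNReal.tsum_eq_zero] at h1
    have h2 := h1 i
    rwa [Measure.map_apply (hTm.iterate i) isClosed_frontier.measurableSet] at h2
  obtain ⟨c, hc⟩ := exists_cell hP
  have hcm := MF_cell hP hc
  obtain ⟨N, hN⟩ := hG P hP hdiam
  have hNk : ∀ᶠ k in atTop, N < nk k := hnk.tendsto_atTop.eventually (eventually_gt_atTop N)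
  have hψi : ∀ (μ : Measure X) [IsFiniteMeasure μ] (j : ℕ),
      Integrable (fun x => ψ (T^[j] x)) μ := by
    intro μ _ j
    have : Continuous (fun x => ψ (T^[j] x)) := hψ.comp (hT.iterate j)
    exact this.integrable_of_hasCompactSupport (HasCompactSupport.of_compactSpace _)
  -- main inequality
  have main : ∀ m : ℕ, 0 < m → ∫ x, ψ x ∂ν ≤ refEnt ν T P m / m := by
    intro m hm
    have hm' : (0:ℝ) < m := by exact_mod_cast hm
    rw [refEnt_eq hc]
    set Lg := Real.log (Fintype.card {A : Set X // A ∈ P}) with hLg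
    have h1 : Tendsto (fun l =>
        ∫ x, ψ x ∂(avgMeas T F ((η (A (φ l)))⁻¹ • η.restrict (A (φ l))) (nk (φ l)))
        + Real.log ((η (A (φ l))).toReal) / (secCard F (nk (φ l)) : ℝ)) atTop
        (𝓝 (∫ x, ψ x ∂ν + 0)) :=
      (hconv ⟨ψ, hψ⟩).add ((ratio_tendsto hc0 hF _ hAsub).comp hφt)
    have h2 : Tendsto (fun l =>
        fEnt (avgMeas T F ((η (A (φ l)))⁻¹ • η.restrict (A (φ l))) (nk (φ l))) (win c T 0 m) / m
        + (secCard (bdry F) (nk (φ l)) : ℝ) / (secCard F (nk (φ l)) : ℝ) * (m * Lg)) atTop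
        (𝓝 (fEnt ν (win c T 0 m) / m + 0 * (m * Lg))) := by
      refine Tendsto.add (Tendsto.div_const ?_ _)
        (((ratio_tendsto hc0 hF _ (folner_tendsto hFol)).comp hφt).mul_const _)
      unfold fEnt
      refine tendsto_finsetSum _ fun a _ => ?_
      exact (Real.continuous_negMulLog.tendsto _).comp
        (hport _ (null_frontier_win ν hT hc hfr' m a))
    rw [add_zero] at h1
    rw [zero_mul, add_zero] at h2
    refine le_of_tendsto_of_tendsto h1 h2 ?_
    filter_upwards [hφt.eventually hFpos, hφt.eventually hNk] with l hl hNl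
    generalize φ l = k at hl hNl
    have hpk := hμ k
    have hl' : (0:ℝ) < secCard F (nk k) := by exact_mod_cast hl
    have e1 := gibbs_lower (MF_tup hcm hTm (sec F (nk k))) η (A k) (hAmeas k) (hApos k)
      (fun x => ∑ j ∈ sec F (nk k), ψ (T^[j] x)) (integrable_finsetSum _ fun j _ => hψi _ j)
      (fun x hx => by
        rw [← dynCell_eq hc]
        exact hN k hNl x hx)
    have e2 := shearer (μ := (η (A k))⁻¹ • η.restrict (A k)) hcm hTm F (nk k) m hm
    have e3 := concave_avg hcm hTm F ((η (A k))⁻¹ • η.restrict (A k)) (nk k) m hl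
    rw [avg_integral hTm F _ _ ψ hψ.measurable (fun j => hψi _ j)]
    rw [← hLg] at e2
    set I := ∫ x, ∑ j ∈ sec F (nk k), ψ (T^[j] x) ∂((η (A k))⁻¹ • η.restrict (A k))
    set lg := Real.log (η (A k)).toReal
    set H := fEnt (avgMeas T F ((η (A k))⁻¹ • η.restrict (A k)) (nk k)) (win c T 0 m)
    set b : ℝ := (secCard (bdry F) (nk k) : ℝ)
    set f : ℝ := (secCard F (nk k) : ℝ)
    have e4 : m * (I + lg) ≤ f * H + m * b * (m * Lg) :=
      (mul_le_mul_of_nonneg_left e1 hm'.le).trans (e2.trans (by linarith))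
    have e5 : f⁻¹ * I + lg / f = (m * (I + lg)) / (m * f) := by field_simp
    have e6 : H / m + b / f * (m * Lg) = (f * H + m * b * (m * Lg)) / (m * f) := by
      field_simp
    rw [e5, e6]
    exact div_le_div_of_nonneg_right e4 (by positivity)
  -- conclusion
  refine le_trans ?_ (le_iSup (fun P : {P : Finset (Set X) // IsPartition P} =>
    ENNReal.ofReal (Filter.liminf (fun n : ℕ => refEnt ν T P.1 n / n) Filter.atTop)) ⟨P, hP⟩)
  apply ENNReal.ofReal_le_ofReal
  refine le_liminf_of_le ?_ ?_
  · refine IsBoundedUnder.isCoboundedUnder_ge (isBoundedUnder_of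
      ⟨Real.log (Fintype.card {A : Set X // A ∈ P}), fun m => ?_⟩)
    apply div_le_of_le_mul₀ (by positivity) (Real.log_natCast_nonneg _)
    rw [refEnt_eq hc]
    refine (fEnt_le_log (MF_win hcm hTm 0 m)).trans (le_of_eq ?_)
    rw [Fintype.card_fun, Fintype.card_fin, Nat.cast_pow, Real.log_pow, mul_comm]
  · filter_upwards [eventually_gt_atTop 0] with m hm
    exact main m hm

end
end

section
/- For every integer k ≥ 2 and every ε > 0 there exists a C^∞ map S:ℝ/ℤ→ℝ/ℤ such that: S is a covering map of degree k with S'(x) > 0 for all x; S preserves Lebesgue (Haar) measure on ℝ/ℤ, and indeed Σ_{z∈S^{−1}(y)} 1/S'(z) = 1 for every y∈ℝ/ℤ; S' is not constant (so S does not have constant Jacobian); and S is C¹-ε-close to the linear map R_k(x) = kx (mod 1), i.e. sup_x d(S(x),R_k(x)) < ε and sup_x |S'(x) − k| < ε. -/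
open MeasureTheory Set
open scoped ENNReal NNReal

noncomputable section

instance fact_zero_lt_one' : Fact ((0:ℝ) < 1) := ⟨one_pos⟩

namespace CircleCover

/-- The lift of the circle diffeomorphism whose inverse is used. -/
def hfun (c t : ℝ) : ℝ := t + c / (2 * Real.pi) * Real.sin (2 * Real.pi * t)

lemma hfun_deriv (c t : ℝ) :
    HasDerivAt (hfun c) (1 + c * Real.cos (2 * Real.pi * t)) t := by
  have h1 : HasDerivAt (fun t : ℝ => 2 * Real.pi * t) (2 * Real.pi) t := by
    simpa using (hasDerivAt_id t).const_mul (2 * Real.pi)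
  have h2 := (hasDerivAt_id t).add ((h1.sin).const_mul (c / (2 * Real.pi)))
  refine h2.congr_deriv ?_
  have := Real.pi_pos.ne'
  field_simp

lemma hfun_add_int (c t : ℝ) (m : ℤ) : hfun c (t + m) = hfun c t + m := by
  have : 2 * Real.pi * (t + m) = 2 * Real.pi * t + m * (2 * Real.pi) := by ring
  unfold hfun
  rw [this, Real.sin_add_int_mul_two_pi]
  ring

lemma dpos {c : ℝ} (hc : 0 < c) (hc2 : c ≤ 1 / 2) (x : ℝ) : 1 / 2 ≤ 1 + c * Real.cos x := by
  have := Real.neg_one_le_cos x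
  nlinarith

lemma hfun_near {c : ℝ} (hc : 0 < c) (t : ℝ) : |hfun c t - t| ≤ c := by
  have h0 : hfun c t - t = c / (2 * Real.pi) * Real.sin (2 * Real.pi * t) := by
    unfold hfun; ring
  rw [h0, abs_mul]
  have h1 := Real.abs_sin_le_one (2 * Real.pi * t)
  have hp : 1 ≤ 2 * Real.pi := by linarith [Real.pi_gt_three]
  have h2 : |c / (2 * Real.pi)| ≤ c := by
    rw [abs_of_pos (by positivity)]
    exact div_le_self hc.le hp
  calc _ ≤ c * 1 := by gcongr
    _ = c := mul_one c

lemma hfun_contDiff (c : ℝ) : ContDiff ℝ (⊤ : ℕ∞) (hfun c) := by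
  unfold hfun
  fun_prop

lemma hfun_strictMono {c : ℝ} (hc : 0 < c) (hc2 : c ≤ 1 / 2) : StrictMono (hfun c) := by
  apply strictMono_of_deriv_pos
  intro x
  rw [(hfun_deriv c x).deriv]
  linarith [dpos hc hc2 (2 * Real.pi * x)]

lemma hfun_surj {c : ℝ} (hc : 0 < c) : Function.Surjective (hfun c) := by
  intro y
  have h1 := abs_le.1 (hfun_near hc (y - c))
  have h2 := abs_le.1 (hfun_near hc (y + c))
  have := intermediate_value_Icc (by linarith : y - c ≤ y + c)
    (hfun_contDiff c).continuous.continuousOn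
  obtain ⟨x, -, hx⟩ := this (show y ∈ Icc (hfun c (y - c)) (hfun c (y + c)) from
    ⟨by linarith, by linarith⟩)
  exact ⟨x, hx⟩

lemma exists_homeo {c : ℝ} (hc : 0 < c) (hc2 : c ≤ 1 / 2) :
    ∃ e : ℝ ≃ₜ ℝ, ∀ t, e t = hfun c t :=
  ⟨((hfun_strictMono hc hc2).orderIsoOfSurjective _ (hfun_surj hc)).toHomeomorph, fun _ => rfl⟩

lemma coe_eq_iff (a b : ℝ) : (a : AddCircle (1 : ℝ)) = b ↔ ∃ m : ℤ, a = b + m := by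
  rw [← sub_eq_zero, ← AddCircle.coe_sub, AddCircle.coe_eq_zero_iff]
  constructor
  · rintro ⟨n, hn⟩
    exact ⟨n, by simp at hn; linarith⟩
  · rintro ⟨n, hn⟩
    exact ⟨n, by simp; linarith⟩

lemma exists_circle_map (f : ℝ → ℝ) (hf : Continuous f) (h1 : ∀ x, f (x + 1) = f x + 1) :
    ∃ U : AddCircle (1 : ℝ) → AddCircle (1 : ℝ), Continuous U ∧ ∀ x : ℝ, U x = (f x : ℝ) := by
  have hp : Function.Periodic (fun x => (f x : AddCircle (1 : ℝ))) 1 := by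
    intro x
    simp only [h1]
    exact AddCircle.coe_add_period 1 (f x)
  refine ⟨hp.lift, ?_, fun x => rfl⟩
  exact ((AddCircle.continuous_mk' 1).comp hf).quotient_lift _

lemma exists_circle_homeo (e : ℝ ≃ₜ ℝ) (h1 : ∀ x, e (x + 1) = e x + 1) :
    ∃ U : AddCircle (1 : ℝ) ≃ₜ AddCircle (1 : ℝ), (∀ x : ℝ, U x = (e x : ℝ)) := by
  obtain ⟨U, hU, hUx⟩ := exists_circle_map e e.continuous h1
  obtain ⟨V, hV, hVx⟩ := exists_circle_map e.symm e.symm.continuous (by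
    intro x
    rw [Homeomorph.symm_apply_eq, h1, e.apply_symm_apply])
  refine ⟨⟨⟨U, V, ?_, ?_⟩, hU, hV⟩, hUx⟩
  · intro x
    induction x using QuotientAddGroup.induction_on with
    | H x => rw [hUx, hVx, e.symm_apply_apply]
  · intro x
    induction x using QuotientAddGroup.induction_on with
    | H x => rw [hVx, hUx, e.apply_symm_apply]

lemma cos_sum (k : ℕ) (hk : 2 ≤ k) (t : ℝ) :
    ∑ j ∈ Finset.range k, Real.cos (2 * Real.pi * (t + j / k)) = 0 := by
  have hprim := Complex.isPrimitiveRoot_exp k (by omega)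
  have hs := hprim.geom_sum_eq_zero (by omega)
  have hk0 : (k : ℂ) ≠ 0 := by
    have : k ≠ 0 := by omega
    exact_mod_cast this
  have h2 : ∑ j ∈ Finset.range k,
      Complex.exp (((2 * Real.pi * (t + j / k) : ℝ) : ℂ) * Complex.I) = 0 := by
    have : ∀ j ∈ Finset.range k,
        Complex.exp (((2 * Real.pi * (t + j / k) : ℝ) : ℂ) * Complex.I) =
        Complex.exp (2 * Real.pi * t * Complex.I) *
          Complex.exp (2 * Real.pi * Complex.I / k) ^ j := by
      intro j _
      rw [← Complex.exp_nat_mul, ← Complex.exp_add]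
      congr 1
      push_cast
      field_simp
    rw [Finset.sum_congr rfl this, ← Finset.mul_sum, hs, mul_zero]
  have h3 := congrArg Complex.re h2
  rw [Complex.re_sum] at h3
  simpa only [Complex.exp_ofReal_mul_I_re, Complex.zero_re] using h3

lemma density_sum (k : ℕ) (hk : 2 ≤ k) (c t : ℝ) :
    ∑ j ∈ Finset.range k, (1 + c * Real.cos (2 * Real.pi * (t + j / k))) = k := by
  rw [Finset.sum_add_distrib, ← Finset.mul_sum, cos_sum k hk]
  simp

lemma measure_aux (k : ℕ) (hk : 2 ≤ k) {c : ℝ} (hc : 0 < c) (hc2 : c ≤ 1 / 2)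
    (S : AddCircle (1 : ℝ) → AddCircle (1 : ℝ)) (hSc : Continuous S)
    (hS : ∀ t : ℝ, S (hfun c t : ℝ) = ((k * t : ℝ) : AddCircle (1 : ℝ)))
    (B : Set (AddCircle (1 : ℝ))) (hB : MeasurableSet B) :
    volume (S ⁻¹' B) = volume B := by
  have hDp : Function.Periodic
      (fun t : ℝ => ENNReal.ofReal (1 + c * Real.cos (2 * Real.pi * t))) 1 := by
    intro t
    have : 2 * Real.pi * (t + 1) = 2 * Real.pi * t + 2 * Real.pi := by ring
    simp only [this, Real.cos_add_two_pi]
  have hDcont : Continuous (hDp.lift : AddCircle (1 : ℝ) → ℝ≥0∞) := by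
    refine Continuous.quotient_lift ?_ _
    exact ENNReal.continuous_ofReal.comp (by fun_prop)
  set D : AddCircle (1 : ℝ) → ℝ≥0∞ := hDp.lift with hDdef
  have hD : ∀ t : ℝ, D t = ENNReal.ofReal (1 + c * Real.cos (2 * Real.pi * t)) := fun t => rfl
  have hRk : MeasurePreserving (fun y : AddCircle (1 : ℝ) => k • y) volume volume :=
    (AddCircle.ergodic_nsmul (by omega : 1 < k)).toMeasurePreserving
  have h1meas : Measurable (B.indicator (1 : AddCircle (1 : ℝ) → ℝ≥0∞)) :=
    measurable_one.indicator hB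
  -- step 1: change of variables
  have step1 : volume (S ⁻¹' B) = ∫⁻ w : AddCircle (1 : ℝ), D w * B.indicator 1 (k • w) := by
    have e1 : volume (S ⁻¹' B) = ∫⁻ w : AddCircle (1 : ℝ), B.indicator 1 (S w) := by
      rw [← lintegral_indicator_one (hSc.measurable hB)]
      rfl
    rw [e1, ← AddCircle.lintegral_preimage 1 0, ← AddCircle.lintegral_preimage 1 0]
    have h0 : hfun c 0 = 0 := by simp [hfun]
    have h01 : hfun c (0 + 1) = 0 + 1 := by
      have := hfun_add_int c 0 1
      rw [h0] at this
      exact_mod_cast this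
    have him : Ioc (0 : ℝ) (0 + 1) = hfun c '' Ioc (0 : ℝ) (0 + 1) := by
      have hm := hfun_strictMono hc hc2
      ext y
      constructor
      · intro hy
        obtain ⟨x, rfl⟩ := hfun_surj hc y
        refine ⟨x, ⟨?_, ?_⟩, rfl⟩
        · rw [← hm.lt_iff_lt, h0]; exact hy.1
        · rw [← hm.le_iff_le, h01]; exact hy.2
      · rintro ⟨x, hx, rfl⟩
        refine ⟨?_, ?_⟩
        · have := hm hx.1
          rwa [h0] at this
        · have := hm.monotone hx.2
          rwa [h01] at this
    conv_lhs => rw [him]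
    rw [lintegral_image_eq_lintegral_abs_deriv_mul measurableSet_Ioc
      (fun x _ => (hfun_deriv c x).hasDerivWithinAt) (hfun_strictMono hc hc2).injective.injOn]
    refine lintegral_congr fun t => ?_
    rw [hS, hD, abs_of_pos (by linarith [dpos hc hc2 (2 * Real.pi * t)]), ← AddCircle.coe_nsmul,
      nsmul_eq_mul]
  have hk0 : (k : ℝ) ≠ 0 := by
    have : k ≠ 0 := by omega
    exact_mod_cast this
  -- step 2: shifts
  have step2 : ∀ j ∈ Finset.range k, ∫⁻ w : AddCircle (1 : ℝ), D w * B.indicator 1 (k • w) =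
      ∫⁻ w : AddCircle (1 : ℝ), D (w + ((j / k : ℝ) : AddCircle (1 : ℝ))) *
        B.indicator 1 (k • w) := by
    intro j _
    rw [← lintegral_add_right_eq_self _ ((j / k : ℝ) : AddCircle (1 : ℝ))]
    refine lintegral_congr fun w => ?_
    congr 2
    rw [smul_add, ← AddCircle.coe_nsmul, nsmul_eq_mul, mul_div_cancel₀ _ hk0]
    have : ((j : ℝ) : AddCircle (1 : ℝ)) = 0 := by
      rw [AddCircle.coe_eq_zero_iff]
      exact ⟨j, by simp⟩
    rw [this, add_zero]
  have step3 : (k : ℝ≥0∞) * ∫⁻ w : AddCircle (1 : ℝ), D w * B.indicator 1 (k • w) =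
      k * volume B := by
    have hs := Finset.sum_congr rfl step2
    rw [Finset.sum_const, Finset.card_range, nsmul_eq_mul] at hs
    rw [hs, ← lintegral_finsetSum]
    · have : ∀ w : AddCircle (1 : ℝ), ∑ j ∈ Finset.range k,
          D (w + ((j / k : ℝ) : AddCircle (1 : ℝ))) * B.indicator 1 (k • w)
          = k * B.indicator 1 (k • w) := by
        intro w
        rw [← Finset.sum_mul]
        congr 1
        induction w using QuotientAddGroup.induction_on with
        | H t =>
          have : ∀ j ∈ Finset.range k,
              D ((t : AddCircle (1 : ℝ)) + ((j / k : ℝ) : AddCircle (1 : ℝ))) =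
              ENNReal.ofReal (1 + c * Real.cos (2 * Real.pi * (t + j / k))) := by
            intro j _
            rw [← AddCircle.coe_add, hD]
          rw [Finset.sum_congr rfl this, ← ENNReal.ofReal_sum_of_nonneg, density_sum k hk]
          · simp
          · intro j _
            linarith [dpos hc hc2 (2 * Real.pi * (t + j / k))]
      rw [lintegral_congr this, lintegral_const_mul (k : ℝ≥0∞)
        (show Measurable fun w : AddCircle (1 : ℝ) => B.indicator (1 : AddCircle (1 : ℝ) → ℝ≥0∞) (k • w) from
          h1meas.comp hRk.measurable),
        hRk.lintegral_comp h1meas, lintegral_indicator_one hB]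
    · intro j _
      exact ((hDcont.comp (continuous_add_const _)).measurable).mul (h1meas.comp hRk.measurable)
  rw [step1]
  refine (ENNReal.mul_right_inj ?_ ?_).1 step3
  · have : k ≠ 0 := by omega
    exact_mod_cast this
  · exact ENNReal.natCast_ne_top k

end CircleCover

open CircleCover

/-- For every integer `k ≥ 2` and every `ε > 0` there is a `C^∞`
degree-`k` covering map `S` of the circle `ℝ/ℤ` (encoded by a lift `s : ℝ → ℝ` with
`s(x+1) = s(x) + k` and `s' > 0`) which preserves Haar measure — indeed
`∑_{z ∈ S⁻¹(y)} 1/S'(z) = 1` for every `y` — whose derivative is not constant, and which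
is `C¹`-`ε`-close to the linear map `R_k(x) = kx (mod 1)`. -/
theorem exists_conservative_nonlinear_circle_cover (k : ℕ) (hk : 2 ≤ k) (ε : ℝ)
    (hε : 0 < ε) :
    ∃ (s : ℝ → ℝ) (S : AddCircle (1 : ℝ) → AddCircle (1 : ℝ)) (Sd : AddCircle (1 : ℝ) → ℝ),
      ContDiff ℝ (⊤ : ℕ∞) s ∧
      (∀ x : ℝ, s (x + 1) = s x + k) ∧
      (∀ x : ℝ, S ↑x = ↑(s x)) ∧
      (∀ x : ℝ, Sd ↑x = deriv s x) ∧
      (∀ x : ℝ, 0 < deriv s x) ∧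
      IsCoveringMap S ∧
      (∀ y : AddCircle (1 : ℝ), (S ⁻¹' {y}).ncard = k) ∧
      (∀ B : Set (AddCircle (1 : ℝ)), MeasurableSet B → volume (S ⁻¹' B) = volume B) ∧
      (∀ y : AddCircle (1 : ℝ), ∑ᶠ z ∈ S ⁻¹' {y}, (Sd z)⁻¹ = 1) ∧
      (∃ x₁ x₂ : ℝ, deriv s x₁ ≠ deriv s x₂) ∧
      (∀ x : AddCircle (1 : ℝ), dist (S x) (k • x) < ε) ∧
      (∀ x : ℝ, |deriv s x - (k : ℝ)| < ε) := by
  obtain ⟨c, hc, hc2, hcε⟩ : ∃ c : ℝ, 0 < c ∧ c ≤ 1 / 2 ∧ 2 * (k * c) < ε := by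
    have hkp : (0 : ℝ) < k := by
      have : 0 < k := by omega
      exact_mod_cast this
    refine ⟨min (1 / 2) (ε / (4 * k)), by positivity, min_le_left _ _, ?_⟩
    have h1 : k * min (1 / 2) (ε / (4 * k)) ≤ k * (ε / (4 * k)) := by
      gcongr
      exact min_le_right _ _
    have h2 : k * (ε / (4 * k)) = ε / 4 := by field_simp
    linarith
  have hkp : (0 : ℝ) < k := by
    have : 0 < k := by omega
    exact_mod_cast this
  have hk0 : (k : ℝ) ≠ 0 := hkp.ne'
  obtain ⟨e, he⟩ := exists_homeo hc hc2
  have hcoe : ⇑e = hfun c := funext he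
  set u : ℝ → ℝ := ⇑e.symm with hu
  have hue : ∀ t, u (hfun c t) = t := fun t => by rw [← he]; exact e.symm_apply_apply t
  have heu : ∀ x, hfun c (u x) = x := fun x => by rw [← he]; exact e.apply_symm_apply x
  have hu1 : ∀ x, u (x + 1) = u x + 1 := by
    intro x
    have := hfun_add_int c (u x) 1
    rw [heu] at this
    have h2 := hue (u x + (1 : ℤ))
    rw [this] at h2
    exact_mod_cast h2
  obtain ⟨U, hU⟩ := exists_circle_homeo e.symm hu1
  have hsymm : ContDiff ℝ (⊤ : ℕ∞) u := by
    refine e.contDiff_symm_deriv (f' := fun t => 1 + c * Real.cos (2 * Real.pi * t)) ?_ ?_ ?_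
    · intro x
      have := dpos hc hc2 (2 * Real.pi * x)
      exact ne_of_gt (by linarith)
    · intro x
      rw [hcoe]
      exact hfun_deriv c x
    · rw [hcoe]
      exact hfun_contDiff c
  have hd : ∀ x, deriv (fun x => k * u x) x = k / (1 + c * Real.cos (2 * Real.pi * u x)) := by
    intro x
    have hx : HasDerivAt u (1 + c * Real.cos (2 * Real.pi * u x))⁻¹ x := by
      refine HasDerivAt.of_local_left_inverse (f := hfun c) hsymm.continuous.continuousAt
        (hfun_deriv c (u x)) ?_ (Filter.Eventually.of_forall heu)
      have := dpos hc hc2 (2 * Real.pi * u x)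
      exact ne_of_gt (by linarith)
    rw [(hx.const_mul (k : ℝ)).deriv, div_eq_mul_inv]
  have hSdp : Function.Periodic (fun x => deriv (fun x => k * u x) x) 1 := by
    intro x
    simp only [hd]
    rw [hu1]
    have : 2 * Real.pi * (u x + 1) = 2 * Real.pi * u x + 2 * Real.pi := by ring
    rw [this, Real.cos_add_two_pi]
  have hS : ∀ x : ℝ, k • U x = ((k * u x : ℝ) : AddCircle (1 : ℝ)) := by
    intro x
    rw [hU, ← AddCircle.coe_nsmul, nsmul_eq_mul]
  have hcov : IsCoveringMap (fun x => k • U x) := by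
    have : NeZero k := ⟨by omega⟩
    exact (AddCircle.isAddQuotientCoveringMap_nsmul_of_ne_zero (1 : ℝ) k).isCoveringMap.comp_homeomorph U
  -- the fibres
  have hfib : ∀ Y : ℝ, (fun x => k • U x) ⁻¹' {(Y : AddCircle (1 : ℝ))} =
      (fun j : ℕ => (hfun c (Y / k + j / k) : AddCircle (1 : ℝ))) '' (Finset.range k : Set ℕ) := by
    intro Y
    ext z
    induction z using QuotientAddGroup.induction_on with
    | H x =>
      simp only [mem_preimage, mem_singleton_iff, mem_image, Finset.coe_range, mem_Iio]
      rw [hS, coe_eq_iff]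
      constructor
      · rintro ⟨m, hm⟩
        have hkz : (k : ℤ) ≠ 0 := by omega
        have hpos := Int.emod_nonneg m hkz
        have hlt := Int.emod_lt_of_pos m (by omega : (0 : ℤ) < k)
        have hdm := Int.emod_add_mul_ediv m k
        refine ⟨(m % k).toNat, by omega, ?_⟩
        refine Eq.symm ((coe_eq_iff _ _).2 ⟨m / k, ?_⟩)
        rw [← hfun_add_int]
        conv_lhs => rw [← heu x]
        congr 1
        have hc1 : (((m % k).toNat : ℕ) : ℝ) = ((m % k : ℤ) : ℝ) := by
          have := Int.toNat_of_nonneg hpos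
          exact_mod_cast congrArg (Int.cast : ℤ → ℝ) this
        have hc3 : ((m % k : ℤ) : ℝ) + k * ((m / k : ℤ) : ℝ) = m := by exact_mod_cast hdm
        rw [hc1]
        field_simp
        linarith
      · rintro ⟨j, hj, hje⟩
        obtain ⟨m, hm⟩ := (coe_eq_iff _ _).1 hje.symm
        rw [← hfun_add_int] at hm
        refine ⟨j + k * m, ?_⟩
        rw [hm, hue]
        push_cast
        field_simp
        ring
  have hinj : ∀ Y : ℝ, InjOn (fun j : ℕ => (hfun c (Y / k + j / k) : AddCircle (1 : ℝ)))
      (Finset.range k : Set ℕ) := by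
    intro Y i hi j hj hij
    simp only [Finset.coe_range, mem_Iio] at hi hj
    obtain ⟨m, hm⟩ := (coe_eq_iff _ _).1 hij
    rw [← hfun_add_int] at hm
    have h2 := (hfun_strictMono hc hc2).injective hm
    have h3 : (i : ℝ) = j + k * m := by
      field_simp at h2
      linarith
    have h4 : (i : ℤ) = j + k * m := by exact_mod_cast h3
    have h5 : (i : ℤ) % k = j % k := by rw [h4]; simp
    rw [Int.emod_eq_of_lt (by omega) (by omega), Int.emod_eq_of_lt (by omega) (by omega)] at h5
    omega
  refine ⟨fun x => k * u x, fun x => k • U x, hSdp.lift, ?_, ?_, hS, fun x => rfl, ?_, hcov,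
    ?_, ?_, ?_, ?_, ?_, ?_⟩
  · exact contDiff_const.mul hsymm
  · intro x
    simp only [hu1]
    ring
  · intro x
    rw [hd]
    have := dpos hc hc2 (2 * Real.pi * u x)
    exact div_pos hkp (by linarith)
  · intro y
    induction y using QuotientAddGroup.induction_on with
    | H Y =>
      rw [hfib, (hinj Y).ncard_image, Set.ncard_coe_finset, Finset.card_range]
  · intro B hB
    refine measure_aux k hk hc hc2 _ hcov.continuous ?_ B hB
    intro t
    simp only [hS, hue]
  · intro y
    induction y using QuotientAddGroup.induction_on with
    | H Y =>
      rw [hfib, finsum_mem_image (hinj Y), finsum_mem_coe_finset]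
      have : ∀ j ∈ Finset.range k,
          (hSdp.lift ((hfun c (Y / k + j / k) : ℝ) : AddCircle (1 : ℝ)))⁻¹ =
          (1 + c * Real.cos (2 * Real.pi * (Y / k + j / k))) / k := by
        intro j _
        change (deriv (fun x => k * u x) (hfun c (Y / k + j / k)))⁻¹ = _
        rw [hd, hue, inv_div]
      rw [Finset.sum_congr rfl this, ← Finset.sum_div, density_sum k hk, div_self hk0]
  · refine ⟨hfun c 0, hfun c (1 / 2), ?_⟩
    rw [hd, hd, hue, hue]
    have h1 : 2 * Real.pi * (1 / 2) = Real.pi := by ring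
    rw [h1, mul_zero, Real.cos_zero, Real.cos_pi]
    intro h
    rw [div_eq_div_iff (by linarith) (by linarith)] at h
    have := mul_left_cancel₀ hk0 h
    linarith
  · intro x
    induction x using QuotientAddGroup.induction_on with
    | H x =>
      have hx : (k : ℕ) • (x : AddCircle (1 : ℝ)) = ((k * x : ℝ) : AddCircle (1 : ℝ)) := by
        rw [← AddCircle.coe_nsmul, nsmul_eq_mul]
      change dist (k • U x) (k • (x : AddCircle (1 : ℝ))) < ε
      rw [hS, hx, dist_eq_norm, ← AddCircle.coe_sub]
      refine lt_of_le_of_lt (QuotientAddGroup.norm_mk_le_norm) ?_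
      have h1 := hfun_near hc (u x)
      rw [heu, abs_sub_comm] at h1
      rw [← mul_sub, Real.norm_eq_abs, abs_mul, abs_of_pos hkp]
      have : k * |u x - x| ≤ k * c := by gcongr
      have : 0 < k * c := by positivity
      linarith
  · intro x
    rw [hd]
    have hp := dpos hc hc2 (2 * Real.pi * u x)
    have hq : 0 < 1 + c * Real.cos (2 * Real.pi * u x) := by linarith
    have h1 : k / (1 + c * Real.cos (2 * Real.pi * u x)) - k =
        -(k * (c * Real.cos (2 * Real.pi * u x))) / (1 + c * Real.cos (2 * Real.pi * u x)) := by
      field_simp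
      ring
    rw [h1, abs_div, abs_of_pos hq, abs_neg, abs_mul, abs_mul, abs_of_pos hkp, abs_of_pos hc]
    have h2 := Real.abs_cos_le_one (2 * Real.pi * u x)
    have h3 : k * (c * |Real.cos (2 * Real.pi * u x)|) ≤ k * (c * 1) := by gcongr
    rw [div_lt_iff₀ hq]
    nlinarith

end
end
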